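/- Let $\mathcal P$, $\Psi$, $I_0$ and $\{h_m\}$ satisfy the hypotheses of the reconstruction theorem: $\sup_{i,j} p^j_i < \infty$, $\{h_m\}$ satisfies (h1)–(h3) on $I_0$, $\lim_{m \to \infty} \int_{\{x \in I_0 : \Psi^*(x) > h_m(x)\}} h_m(x)\,dx = 0$, and $\Psi'$ exists a.e. on $I_0$. Let $I = [n_1/m^1_{k_1},(n_1+1)/m^1_{k_1}] \times \dots \times [n_d/m^d_{k_d},(n_d+1)/m^d_{k_d}] \subset I_0$ be a product of $\mathcal P$-adic intervals of possibly different ranks $k_1,\dots,k_d$. Then $I$ can be written as a union of finitely many parallelepipeds $I_1,\dots,I_s \in \Lambda^d$ with pairwise disjoint interiors, and setting $\Psi(I) := \sum_{i=1}^s \Psi(I_i)$ (which is independent of the decomposition), one has $\Psi(I) = \lim_{m \to \infty} \int_I [\Psi'(x)]_{h_m(x)}\,dx$. -/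

import Mathlib

open MeasureTheory Filter Topology

noncomputable section

/-- `mseq p k = ∏_{i<k} p i`, i.e. the product `m_k = p_1 ⋯ p_k` generated by the
sequence `p` (indexed from `0` in Lean). -/
def mseq (p : ℕ → ℕ) (k : ℕ) : ℕ := ∏ i ∈ Finset.range k, p i

/-- The `𝒫`-adic parallelepiped of rank `k` with corner index `n`, i.e.
`[n₁/m¹ₖ, (n₁+1)/m¹ₖ] × ⋯ × [n_d/mᵈₖ, (n_d+1)/mᵈₖ]`. -/
def cell {d : ℕ} (p : Fin d → ℕ → ℕ) (k : ℕ) (n : Fin d → ℤ) : Set (Fin d → ℝ) :=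
  Set.univ.pi fun j =>
    Set.Icc ((n j : ℝ) / (mseq (p j) k : ℝ)) (((n j : ℝ) + 1) / (mseq (p j) k : ℝ))

/-- `Λᵈ`, the collection of all `𝒫`-adic parallelepipeds (of all ranks). -/
def Lambda {d : ℕ} (p : Fin d → ℕ → ℕ) : Set (Set (Fin d → ℝ)) :=
  {I | ∃ k n, I = cell p k n}

/-- `Ψ` is additive on the `𝒫`-adic parallelepipeds: whenever `I ∈ Λᵈ` is the union of
finitely many members of `Λᵈ` with pairwise disjoint interiors, `Ψ I` is the sum of their
values. -/
def IsAdditive {d : ℕ} (p : Fin d → ℕ → ℕ) (Ψ : Set (Fin d → ℝ) → ℂ) : Prop :=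
  ∀ (I : Set (Fin d → ℝ)) (s : ℕ) (J : Fin s → Set (Fin d → ℝ)),
    I ∈ Lambda p → (∀ i, J i ∈ Lambda p) →
    (∀ i j, i ≠ j → Disjoint (interior (J i)) (interior (J j))) →
    (⋃ i, J i) = I → Ψ I = ∑ i, Ψ (J i)

/-- The `𝒫`-adic parallelepiped of rank `k` containing `x`; for a `𝒫`-irrational point `x`
it is the unique member of `Λᵈ_k` containing `x`. -/
def cellAt {d : ℕ} (p : Fin d → ℕ → ℕ) (k : ℕ) (x : Fin d → ℝ) : Set (Fin d → ℝ) :=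
  cell p k fun j => ⌊x j * (mseq (p j) k : ℝ)⌋

/-- The set `{x | Ψ*(x) > lam x}`, where `Ψ*(x) = sup {‖Ψ I‖/μ(I) | I ∈ Λᵈ, x ∈ I}` is the
majorant of `Ψ`. -/
def starGt {d : ℕ} (p : Fin d → ℕ → ℕ) (Ψ : Set (Fin d → ℝ) → ℂ)
    (lam : (Fin d → ℝ) → ℝ) : Set (Fin d → ℝ) :=
  {x | ∃ I ∈ Lambda p, x ∈ I ∧ lam x < ‖Ψ I‖ / (volume I).toReal}

/-- Truncation of `f` by the function `lam`: `[f(x)]_{lam(x)}`. -/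
def trunc {α : Type*} (f : α → ℂ) (lam : α → ℝ) (x : α) : ℂ :=
  if ‖f x‖ ≤ lam x then f x else 0

/-- Conditions (h1)–(h3) on the sequence of functions `h m : I₀ → ℝ`:
(h1) `0 ≤ h 1 ≤ h 2 ≤ ⋯` and `h m x → ∞` on `I₀`; (h2)–(h3) there are a constant `C > 0`
and, for each `m`, parallelepipeds `J 1, …, J s ∈ Λᵈ` with pairwise disjoint interiors and
union `I₀` on each of which `sup h m ≤ C * inf h m`, and with `inf_{m,i} ∫_{J i} h m > 0`. -/
def HConds {d : ℕ} (p : Fin d → ℕ → ℕ) (I0 : Set (Fin d → ℝ))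
    (h : ℕ → (Fin d → ℝ) → ℝ) : Prop :=
  (∀ x ∈ I0, (∀ m, 0 ≤ h m x) ∧ (Monotone fun m => h m x) ∧
      Tendsto (fun m => h m x) atTop atTop) ∧
  ∃ C > (0 : ℝ), ∃ ε > (0 : ℝ), ∀ m : ℕ, ∃ (s : ℕ) (J : Fin s → Set (Fin d → ℝ)),
    (∀ i, J i ∈ Lambda p) ∧
    (∀ i j, i ≠ j → Disjoint (interior (J i)) (interior (J j))) ∧
    (⋃ i, J i) = I0 ∧
    (∀ i, ∀ x ∈ J i, ∀ y ∈ J i, h m x ≤ C * h m y) ∧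
    (∀ i, ε ≤ ∫ x in J i, h m x)


section Geometry

variable {d : ℕ} {p : Fin d → ℕ → ℕ}

lemma mseq_pos {q : ℕ → ℕ} (hq : ∀ i, 2 ≤ q i) (k : ℕ) : 0 < mseq q k :=
  Finset.prod_pos fun i _ => by have := hq i; omega

lemma mseq_dvd (q : ℕ → ℕ) {k l : ℕ} (h : k ≤ l) : mseq q k ∣ mseq q l :=
  Finset.prod_dvd_prod_of_subset _ _ _ (Finset.range_subset_range.2 h)

/-- The product of the intervals `[n j / m j, (n j + 1) / m j]`. -/
def gridBox (m : Fin d → ℕ) (n : Fin d → ℤ) : Set (Fin d → ℝ) :=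
  Set.univ.pi fun j => Set.Icc ((n j : ℝ) / (m j : ℝ)) (((n j : ℝ) + 1) / (m j : ℝ))

lemma cell_eq_gridBox (k : ℕ) (n : Fin d → ℤ) : cell p k n = gridBox (fun j => mseq (p j) k) n :=
  rfl

lemma isClosed_gridBox (m : Fin d → ℕ) (n : Fin d → ℤ) : IsClosed (gridBox m n) :=
  isClosed_set_pi fun _ _ => isClosed_Icc

lemma mem_gridBox {m : Fin d → ℕ} (hm : ∀ j, 0 < m j) {n : Fin d → ℤ} {x : Fin d → ℝ} :
    x ∈ gridBox m n ↔ ∀ j, (n j : ℝ) ≤ x j * m j ∧ x j * m j ≤ n j + 1 := by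
  simp only [gridBox, Set.mem_univ_pi, Set.mem_Icc]
  refine forall_congr' fun j => ?_
  have : (0 : ℝ) < m j := by exact_mod_cast hm j
  rw [div_le_iff₀ this, le_div_iff₀ this]

lemma interior_gridBox (m : Fin d → ℕ) (n : Fin d → ℤ) :
    interior (gridBox m n) = Set.univ.pi fun j =>
      Set.Ioo ((n j : ℝ) / (m j : ℝ)) (((n j : ℝ) + 1) / (m j : ℝ)) := by
  rw [gridBox, interior_pi_set Set.finite_univ]
  simp [interior_Icc]

lemma mem_interior_gridBox {m : Fin d → ℕ} (hm : ∀ j, 0 < m j) {n : Fin d → ℤ}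
    {x : Fin d → ℝ} :
    x ∈ interior (gridBox m n) ↔ ∀ j, (n j : ℝ) < x j * m j ∧ x j * m j < n j + 1 := by
  simp only [interior_gridBox, Set.mem_univ_pi, Set.mem_Ioo]
  refine forall_congr' fun j => ?_
  have : (0 : ℝ) < m j := by exact_mod_cast hm j
  rw [div_lt_iff₀ this, lt_div_iff₀ this]

lemma floor_of_mem_interior_gridBox {m : Fin d → ℕ} (hm : ∀ j, 0 < m j) {n : Fin d → ℤ}
    {x : Fin d → ℝ} (hx : x ∈ interior (gridBox m n)) (j : Fin d) : ⌊x j * m j⌋ = n j := by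
  have := (mem_interior_gridBox hm).1 hx j
  exact Int.floor_eq_iff.2 ⟨this.1.le, this.2⟩

lemma interior_gridBox_ae_eq (m : Fin d → ℕ) (n : Fin d → ℤ) :
    interior (gridBox m n) =ᵐ[volume] gridBox m n := by
  rw [interior_gridBox]
  exact Measure.pi_Ioo_ae_eq_pi_Icc

lemma closure_interior_gridBox {m : Fin d → ℕ} (hm : ∀ j, 0 < m j) (n : Fin d → ℤ) :
    closure (interior (gridBox m n)) = gridBox m n := by
  rw [interior_gridBox, closure_pi_set, gridBox]
  congr 1
  funext j
  have : (0 : ℝ) < m j := by exact_mod_cast hm j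
  refine closure_Ioo (ne_of_lt ?_)
  gcongr
  linarith

lemma volume_gridBox (m : Fin d → ℕ) (n : Fin d → ℤ) :
    volume (gridBox m n) = ENNReal.ofReal (∏ j, (m j : ℝ)⁻¹) := by
  rw [gridBox, volume_pi_pi, ENNReal.ofReal_prod_of_nonneg fun _ _ => by positivity]
  refine Finset.prod_congr rfl fun j _ => ?_
  rw [Real.volume_Icc]
  congr 1
  ring

lemma volume_real_gridBox (m : Fin d → ℕ) (n : Fin d → ℤ) :
    volume.real (gridBox m n) = ∏ j, (m j : ℝ)⁻¹ := by
  rw [measureReal_def, volume_gridBox, ENNReal.toReal_ofReal (by positivity)]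

lemma volume_real_gridBox_pos {m : Fin d → ℕ} (hm : ∀ j, 0 < m j) (n : Fin d → ℤ) :
    0 < volume.real (gridBox m n) := by
  rw [volume_real_gridBox]
  refine Finset.prod_pos fun j _ => ?_
  have : (0 : ℝ) < m j := by exact_mod_cast hm j
  positivity

/-- The corner of the sub-box with index `c` of the box with corner `n`. -/
def subCorner (q : Fin d → ℕ) (n : Fin d → ℤ) (c : (j : Fin d) → Fin (q j)) : Fin d → ℤ :=
  fun j => n j * q j + (c j : ℕ)

lemma iUnion_gridBox {m q : Fin d → ℕ} (hm : ∀ j, 0 < m j) (hq : ∀ j, 0 < q j)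
    (n : Fin d → ℤ) :
    (⋃ c : (j : Fin d) → Fin (q j), gridBox (fun j => m j * q j) (subCorner q n c)) =
      gridBox m n := by
  have hmq : ∀ j, 0 < m j * q j := fun j => Nat.mul_pos (hm j) (hq j)
  ext x
  simp only [Set.mem_iUnion, mem_gridBox hm, mem_gridBox hmq, subCorner]
  push_cast
  constructor
  · rintro ⟨c, hc⟩ j
    obtain ⟨h1, h2⟩ := hc j
    have hqj : (0 : ℝ) < q j := by exact_mod_cast hq j
    have hc1 : ((c j : ℕ) : ℝ) + 1 ≤ q j := by exact_mod_cast (c j).2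
    have hc0 : (0 : ℝ) ≤ ((c j : ℕ) : ℝ) := by positivity
    constructor
    · refine le_of_mul_le_mul_right ?_ hqj
      linarith
    · refine le_of_mul_le_mul_right ?_ hqj
      linarith
  · intro hx
    have key : ∀ j, ∃ c : Fin (q j), (n j : ℝ) * q j + ((c : ℕ) : ℝ) ≤ x j * (m j * q j) ∧
        x j * (m j * q j) ≤ (n j : ℝ) * q j + ((c : ℕ) : ℝ) + 1 := by
      intro j
      obtain ⟨h1, h2⟩ := hx j
      have hqj : (0 : ℝ) < q j := by exact_mod_cast hq j
      set t : ℝ := (x j * m j - n j) * q j with ht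
      have ht0 : 0 ≤ t := mul_nonneg (by linarith) hqj.le
      have htq : t ≤ q j := by nlinarith
      have htx : x j * (m j * q j) = n j * q j + t := by rw [ht]; ring
      rw [htx]
      rcases htq.lt_or_eq with h | h
      · refine ⟨⟨⌊t⌋₊, (Nat.floor_lt ht0).2 h⟩, ?_, ?_⟩
        · linarith [Nat.floor_le ht0]
        · linarith [Nat.lt_floor_add_one t]
      · refine ⟨⟨q j - 1, Nat.sub_lt (hq j) one_pos⟩, ?_, ?_⟩ <;>
        · rw [Nat.cast_pred (hq j)]
          linarith
    choose c hc using key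
    exact ⟨c, hc⟩

lemma disjoint_interior_gridBox {m : Fin d → ℕ} (hm : ∀ j, 0 < m j) {n n' : Fin d → ℤ}
    (h : n ≠ n') : Disjoint (interior (gridBox m n)) (interior (gridBox m n')) := by
  refine Set.disjoint_left.2 fun x hx hx' => h ?_
  funext j
  rw [← floor_of_mem_interior_gridBox hm hx j, ← floor_of_mem_interior_gridBox hm hx' j]

lemma subCorner_injective (q : Fin d → ℕ) (n : Fin d → ℤ) :
    Function.Injective (subCorner q n) := by
  intro c c' h
  funext j
  have := congrFun h j
  simp only [subCorner] at this
  ext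
  omega

lemma gridBox_subset_of_mem_interior {m q : Fin d → ℕ} (hm : ∀ j, 0 < m j)
    (hq : ∀ j, 0 < q j) {n n' : Fin d → ℤ} {x : Fin d → ℝ} (hx : x ∈ interior (gridBox m n))
    (hx' : x ∈ interior (gridBox (fun j => m j * q j) n')) :
    gridBox (fun j => m j * q j) n' ⊆ gridBox m n := by
  have hmq : ∀ j, 0 < m j * q j := fun j => Nat.mul_pos (hm j) (hq j)
  rw [mem_interior_gridBox hm] at hx
  rw [mem_interior_gridBox hmq] at hx'
  intro y hy
  rw [mem_gridBox hmq] at hy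
  rw [mem_gridBox hm]
  intro j
  obtain ⟨a1, a2⟩ := hx j
  obtain ⟨b1, b2⟩ := hx' j
  obtain ⟨c1, c2⟩ := hy j
  push_cast at b1 b2 c1 c2
  have hqj : (0 : ℝ) < q j := by exact_mod_cast hq j
  have e1 : n j * q j < n' j + 1 := by
    have : (n j : ℝ) * q j < n' j + 1 := by nlinarith
    exact_mod_cast this
  have e2 : n' j < (n j + 1) * q j := by
    have : (n' j : ℝ) < (n j + 1) * q j := by nlinarith
    exact_mod_cast this
  have f1 : (n j : ℝ) * q j ≤ n' j := by exact_mod_cast Int.lt_add_one_iff.1 e1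
  have f2 : (n' j : ℝ) + 1 ≤ (n j + 1) * q j := by exact_mod_cast e2
  exact ⟨le_of_mul_le_mul_right (by linarith) hqj, le_of_mul_le_mul_right (by linarith) hqj⟩

lemma cell_subset_of_mem_interior (hp : ∀ j i, 2 ≤ p j i) {k l : ℕ} (hkl : k ≤ l)
    {n n' : Fin d → ℤ} {x : Fin d → ℝ} (hx : x ∈ interior (cell p k n))
    (hx' : x ∈ interior (cell p l n')) : cell p l n' ⊆ cell p k n := by
  choose q hq using fun j => mseq_dvd (p j) hkl
  rw [cell_eq_gridBox, show (fun j => mseq (p j) l) = fun j => mseq (p j) k * q j from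
    funext hq] at hx' ⊢
  refine gridBox_subset_of_mem_interior (fun j => mseq_pos (hp j) k) (fun j => ?_) hx hx'
  exact Nat.pos_of_mul_pos_left (hq j ▸ mseq_pos (hp j) l)

/-- Two `𝒫`-adic parallelepipeds are nested or have disjoint interiors. -/
lemma Lambda_nested (hp : ∀ j i, 2 ≤ p j i) {A B : Set (Fin d → ℝ)} (hA : A ∈ Lambda p)
    (hB : B ∈ Lambda p) : A ⊆ B ∨ B ⊆ A ∨ Disjoint (interior A) (interior B) := by
  obtain ⟨k, n, rfl⟩ := hA
  obtain ⟨l, n', rfl⟩ := hB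
  by_cases hd : Disjoint (interior (cell p k n)) (interior (cell p l n'))
  · exact Or.inr (Or.inr hd)
  obtain ⟨x, hx, hx'⟩ := Set.not_disjoint_iff.1 hd
  rcases le_total k l with h | h
  · exact Or.inr (Or.inl (cell_subset_of_mem_interior hp h hx hx'))
  · exact Or.inl (cell_subset_of_mem_interior hp h hx' hx)

lemma isClosed_of_mem_Lambda {A : Set (Fin d → ℝ)} (hA : A ∈ Lambda p) : IsClosed A := by
  obtain ⟨k, n, rfl⟩ := hA
  exact isClosed_gridBox _ _

lemma measurableSet_of_mem_Lambda {A : Set (Fin d → ℝ)} (hA : A ∈ Lambda p) :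
    MeasurableSet A :=
  (isClosed_of_mem_Lambda hA).measurableSet

lemma volume_ne_top_of_mem_Lambda {A : Set (Fin d → ℝ)} (hA : A ∈ Lambda p) :
    volume A ≠ ⊤ := by
  obtain ⟨k, n, rfl⟩ := hA
  rw [cell_eq_gridBox, volume_gridBox]
  exact ENNReal.ofReal_ne_top

lemma volume_real_pos_of_mem_Lambda (hp : ∀ j i, 2 ≤ p j i) {A : Set (Fin d → ℝ)}
    (hA : A ∈ Lambda p) : 0 < volume.real A := by
  obtain ⟨k, n, rfl⟩ := hA
  exact volume_real_gridBox_pos (fun j => mseq_pos (hp j) k) n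

lemma closure_interior_of_mem_Lambda (hp : ∀ j i, 2 ≤ p j i) {A : Set (Fin d → ℝ)}
    (hA : A ∈ Lambda p) : closure (interior A) = A := by
  obtain ⟨k, n, rfl⟩ := hA
  exact closure_interior_gridBox (fun j => mseq_pos (hp j) k) n

lemma nonempty_of_mem_Lambda (hp : ∀ j i, 2 ≤ p j i) {A : Set (Fin d → ℝ)}
    (hA : A ∈ Lambda p) : A.Nonempty := by
  by_contra h
  have := volume_real_pos_of_mem_Lambda hp hA
  simp [Set.not_nonempty_iff_eq_empty.1 h] at this

lemma interior_ae_eq_of_mem_Lambda {A : Set (Fin d → ℝ)} (hA : A ∈ Lambda p) :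
    interior A =ᵐ[volume] A := by
  obtain ⟨k, n, rfl⟩ := hA
  exact interior_gridBox_ae_eq _ _

lemma countable_Lambda : (Lambda p).Countable := by
  have : Lambda p = Set.range fun a : ℕ × (Fin d → ℤ) => cell p a.1 a.2 := by
    ext A
    simp [Lambda, eq_comm]
  rw [this]
  exact Set.countable_range _

lemma mem_cellAt (hp : ∀ j i, 2 ≤ p j i) (k : ℕ) (x : Fin d → ℝ) : x ∈ cellAt p k x := by
  rw [cellAt, cell_eq_gridBox, mem_gridBox fun j => mseq_pos (hp j) k]
  exact fun j => ⟨Int.floor_le _, (Int.lt_floor_add_one _).le⟩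

lemma cellAt_mem_Lambda (k : ℕ) (x : Fin d → ℝ) : cellAt p k x ∈ Lambda p := ⟨k, _, rfl⟩

lemma cellAt_of_mem_interior (hp : ∀ j i, 2 ≤ p j i) {k : ℕ} {n : Fin d → ℤ}
    {x : Fin d → ℝ} (hx : x ∈ interior (cell p k n)) : cellAt p k x = cell p k n := by
  rw [cellAt]
  congr 1
  funext j
  exact floor_of_mem_interior_gridBox (m := fun j => mseq (p j) k)
    (fun j => mseq_pos (hp j) k) hx j

lemma iUnion_cell_succ (hp : ∀ j i, 2 ≤ p j i) (k : ℕ) (n : Fin d → ℤ) :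
    (⋃ c : (j : Fin d) → Fin (p j k), cell p (k + 1) (subCorner (fun j => p j k) n c)) =
      cell p k n := by
  have := iUnion_gridBox (m := fun j => mseq (p j) k) (q := fun j => p j k)
    (fun j => mseq_pos (hp j) k) (fun j => by have := hp j k; omega) n
  simpa only [cell_eq_gridBox, mseq, Finset.prod_range_succ] using this

lemma volume_real_cell_succ (k : ℕ) (n n' : Fin d → ℤ) {M : ℕ} (hM : ∀ j i, p j i ≤ M)
    (hp : ∀ j i, 2 ≤ p j i) :
    volume.real (cell p k n) ≤ (M : ℝ) ^ d * volume.real (cell p (k + 1) n') := by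
  rw [cell_eq_gridBox, cell_eq_gridBox, volume_real_gridBox, volume_real_gridBox]
  have : (M : ℝ) ^ d = ∏ _j : Fin d, (M : ℝ) := by simp
  rw [this, ← Finset.prod_mul_distrib]
  refine Finset.prod_le_prod (fun _ _ => by positivity) fun j _ => ?_
  have h1 : (0 : ℝ) < mseq (p j) k := by exact_mod_cast mseq_pos (hp j) k
  have h2 : (0 : ℝ) < p j k := by have := hp j k; exact_mod_cast (by omega : 0 < p j k)
  have h3 : (p j k : ℝ) ≤ M := by exact_mod_cast hM j k
  rw [mseq, mseq, Finset.prod_range_succ, ← mseq]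
  push_cast
  rw [mul_inv, mul_left_comm]
  refine le_mul_of_one_le_right (by positivity) ?_
  rw [← div_eq_mul_inv, one_le_div h2]
  exact h3

lemma aedisjoint_of_mem_Lambda {A B : Set (Fin d → ℝ)} (hA : A ∈ Lambda p)
    (hB : B ∈ Lambda p) (h : Disjoint (interior A) (interior B)) : AEDisjoint volume A B := by
  rw [AEDisjoint, ← measure_congr
    ((interior_ae_eq_of_mem_Lambda hA).inter (interior_ae_eq_of_mem_Lambda hB)),
    h.inter_eq, measure_empty]

lemma setIntegral_iUnion_Lambda {ι E : Type*} [Fintype ι] [NormedAddCommGroup E]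
    [NormedSpace ℝ E] {ν : Measure (Fin d → ℝ)} (hν : ν ≪ volume)
    {J : ι → Set (Fin d → ℝ)} (hJ : ∀ i, J i ∈ Lambda p)
    (hd : ∀ i j, i ≠ j → Disjoint (interior (J i)) (interior (J j)))
    {g : (Fin d → ℝ) → E} (hg : IntegrableOn g (⋃ i, J i) ν) :
    ∫ x in ⋃ i, J i, g x ∂ν = ∑ i, ∫ x in J i, g x ∂ν := by
  rw [integral_iUnion_ae (fun i => (measurableSet_of_mem_Lambda (hJ i)).nullMeasurableSet)
    (fun i j hij => hν (aedisjoint_of_mem_Lambda (hJ i) (hJ j) (hd i j hij))) hg, tsum_fintype]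

lemma IsAdditive.eq_sum {Ψ : Set (Fin d → ℝ) → ℂ} (hΨ : IsAdditive p Ψ) {ι : Type*}
    [Fintype ι] {J : ι → Set (Fin d → ℝ)} (hJ : ∀ i, J i ∈ Lambda p)
    (hd : ∀ i j, i ≠ j → Disjoint (interior (J i)) (interior (J j)))
    {I : Set (Fin d → ℝ)} (hI : I ∈ Lambda p) (hU : (⋃ i, J i) = I) :
    Ψ I = ∑ i, Ψ (J i) := by
  let e := Fintype.equivFin ι
  rw [hΨ I _ (fun i => J (e.symm i)) hI (fun i => hJ _)
    (fun i j hij => hd _ _ fun h => hij (e.symm.injective h))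
    (by rw [← hU]; exact e.symm.surjective.iUnion_comp J)]
  exact e.symm.sum_comp fun i => Ψ (J i)

lemma exists_decomposition_gridBox (hp : ∀ j i, 2 ≤ p j i) (kk : Fin d → ℕ)
    (nn : Fin d → ℤ) :
    ∃ (s : ℕ) (J : Fin s → Set (Fin d → ℝ)), (∀ i, J i ∈ Lambda p) ∧
      (∀ i j, i ≠ j → Disjoint (interior (J i)) (interior (J j))) ∧
      (⋃ i, J i) = gridBox (fun j => mseq (p j) (kk j)) nn := by
  obtain ⟨K, hK⟩ : ∃ K, ∀ j, kk j ≤ K :=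
    ⟨Finset.univ.sup kk, fun j => Finset.le_sup (Finset.mem_univ j)⟩
  choose q hq using fun j => mseq_dvd (p j) (hK j)
  have hq0 : ∀ j, 0 < q j := fun j =>
    Nat.pos_of_mul_pos_left (hq j ▸ mseq_pos (hp j) K)
  let e := Fintype.equivFin ((j : Fin d) → Fin (q j))
  refine ⟨_, fun i => cell p K (subCorner q nn (e.symm i)), fun i => ⟨_, _, rfl⟩,
    fun i j hij => disjoint_interior_gridBox (fun j => mseq_pos (hp j) K)
      fun h => hij (e.symm.injective (subCorner_injective q nn h)), ?_⟩
  rw [e.symm.surjective.iUnion_comp fun c => cell p K (subCorner q nn c),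
    ← iUnion_gridBox (fun j => mseq_pos (hp j) (kk j)) hq0 nn]
  simp only [cell_eq_gridBox, hq]

/-- A parallelepiped contained in a finite union of non-overlapping parallelepipeds `J i` is
either contained in one of them, or the union of those `J i` that it contains. -/
lemma subset_or_iUnion_eq (hp : ∀ j i, 2 ≤ p j i) {ι : Type*} [Finite ι]
    {J : ι → Set (Fin d → ℝ)} (hJ : ∀ i, J i ∈ Lambda p) {I : Set (Fin d → ℝ)}
    (hI : I ∈ Lambda p) (hU : I ⊆ ⋃ i, J i) :
    (∃ i, I ⊆ J i) ∨ (⋃ i : {i // J i ⊆ I}, J i) = I := by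
  by_cases hex : ∃ i, I ⊆ J i
  · exact Or.inl hex
  push Not at hex
  refine Or.inr (Set.Subset.antisymm (Set.iUnion_subset fun i => i.2) ?_)
  rw [← closure_interior_of_mem_Lambda hp hI]
  refine closure_minimal (fun x hx => ?_)
    (isClosed_iUnion_of_finite fun i => isClosed_of_mem_Lambda (hJ i))
  obtain ⟨i, hi⟩ := Set.mem_iUnion.1 (hU (interior_subset hx))
  rw [closure_interior_of_mem_Lambda hp hI]
  refine Set.mem_iUnion.2 ⟨⟨i, ?_⟩, hi⟩
  rcases Lambda_nested hp hI (hJ i) with h | h | h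
  · exact absurd h (hex i)
  · exact h
  · have := h.closure_right isOpen_interior
    rw [closure_interior_of_mem_Lambda hp (hJ i)] at this
    exact absurd hi (Set.disjoint_left.1 this hx)

end Geometry

section Reconstruction

variable {d : ℕ} {p : Fin d → ℕ → ℕ} {Ψ : Set (Fin d → ℝ) → ℂ}

/-- The average of `Ψ` over the parallelepiped of rank `k` containing `x`. -/
def cellAvg (p : Fin d → ℕ → ℕ) (Ψ : Set (Fin d → ℝ) → ℂ) (k : ℕ) (x : Fin d → ℝ) : ℂ :=
  Ψ (cellAt p k x) / ((volume (cellAt p k x)).toReal : ℂ)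

lemma measurable_cellAvg (k : ℕ) : Measurable (cellAvg p Ψ k) := by
  have h : Measurable fun x : Fin d → ℝ => fun j => ⌊x j * (mseq (p j) k : ℝ)⌋ :=
    measurable_pi_lambda _ fun j => ((measurable_pi_apply j).mul_const _).floor
  exact (measurable_of_countable fun n : Fin d → ℤ =>
    Ψ (cell p k n) / ((volume (cell p k n)).toReal : ℂ)).comp h

lemma norm_cellAvg (k : ℕ) (x : Fin d → ℝ) :
    ‖cellAvg p Ψ k x‖ = ‖Ψ (cellAt p k x)‖ / (volume (cellAt p k x)).toReal := by
  rw [cellAvg, norm_div, Complex.norm_real, Real.norm_of_nonneg ENNReal.toReal_nonneg]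

lemma norm_cellAvg_le_of_notMem_starGt (hp : ∀ j i, 2 ≤ p j i) {H : (Fin d → ℝ) → ℝ}
    {x : Fin d → ℝ} (hx : x ∉ starGt p Ψ H) (k : ℕ) : ‖cellAvg p Ψ k x‖ ≤ H x := by
  rw [norm_cellAvg]
  by_contra! h
  exact hx ⟨_, cellAt_mem_Lambda k x, mem_cellAt hp k x, h⟩

lemma norm_sub_setIntegral_cellAvg_le (hp : ∀ j i, 2 ≤ p j i) {M : ℕ} (hM : ∀ j i, p j i ≤ M)
    (hΨ : IsAdditive p Ψ) {F Z : Set (Fin d → ℝ)} (hF : NullMeasurableSet F volume)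
    {lam : ℝ} (hlam : 0 ≤ lam)
    (hbad : ∀ Q ∈ Lambda p, lam * volume.real Q < ‖Ψ Q‖ → Q ∩ Z ⊆ F)
    (hcellAvg : ∀ k, ∀ x ∈ Z, x ∉ F → ‖cellAvg p Ψ k x‖ ≤ lam) (n : ℕ) :
    ∀ (k : ℕ) (c : Fin d → ℤ), cell p k c ⊆ Z →
      ‖Ψ (cell p k c)‖ ≤ lam * volume.real (cell p k c) →
      ‖Ψ (cell p k c) - ∫ x in cell p k c, cellAvg p Ψ (k + n) x ∂volume.restrict Fᶜ‖ ≤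
        (2 * (M : ℝ) ^ d + 1) * lam * (volume.restrict F).real (cell p k c) := by
  set ν := volume.restrict Fᶜ with hν
  have hνv : ν ≪ volume := Measure.absolutelyContinuous_of_le Measure.restrict_le_self
  have hbound : ∀ k, ∀ᵐ x ∂ν, x ∈ Z → ‖cellAvg p Ψ k x‖ ≤ lam := fun k =>
    (ae_restrict_mem₀ hF.compl).mono fun x hx hxZ => hcellAvg k x hxZ hx
  have hfin : ∀ {Q}, Q ∈ Lambda p → ν Q < ⊤ := fun hQ =>
    (Measure.restrict_apply_le _ _).trans_lt (volume_ne_top_of_mem_Lambda hQ).lt_top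
  have hboundQ : ∀ {Q}, Q ∈ Lambda p → Q ⊆ Z → ∀ k, ∀ᵐ x ∂ν.restrict Q,
      ‖cellAvg p Ψ k x‖ ≤ lam := fun hQ hQZ k => by
    filter_upwards [ae_restrict_of_ae (hbound k),
      ae_restrict_mem (measurableSet_of_mem_Lambda hQ)] with x h1 h2 using h1 (hQZ h2)
  have hint : ∀ {Q}, Q ∈ Lambda p → Q ⊆ Z → ∀ k, IntegrableOn (cellAvg p Ψ k) Q ν :=
    fun hQ hQZ k => by
      have : IsFiniteMeasure (ν.restrict _) := ⟨by simpa using hfin hQ⟩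
      exact Integrable.of_bound (measurable_cellAvg k).aestronglyMeasurable lam
        (hboundQ hQ hQZ k)
  induction n with
  | zero =>
    intro k c hcZ hc
    set Q := cell p k c with hQdef
    have hQ : Q ∈ Lambda p := ⟨k, c, rfl⟩
    have hQpos := volume_real_pos_of_mem_Lambda hp hQ
    have hsplit : volume.real Q = (volume.restrict F).real Q + ν.real Q := by
      have hQm := measurableSet_of_mem_Lambda hQ
      have hQfin := volume_ne_top_of_mem_Lambda hQ
      rw [measureReal_restrict_apply hQm, measureReal_restrict_apply hQm, ← Set.sdiff_eq,
        measureReal_inter_add_sdiff₀ hF hQfin]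
    have hae : ∀ᵐ x ∂ν.restrict Q,
        cellAvg p Ψ (k + 0) x = Ψ Q / ((volume.real Q : ℝ) : ℂ) := by
      have h1 : ∀ᵐ x ∂ν, x ∈ Q → x ∈ interior Q :=
        hνv.ae_le (by
          filter_upwards [interior_ae_eq_of_mem_Lambda hQ] with x hx hxQ
          exact hx.mpr hxQ)
      filter_upwards [ae_restrict_of_ae h1,
        ae_restrict_mem (measurableSet_of_mem_Lambda hQ)] with x h1 h2
      rw [cellAvg, add_zero, cellAt_of_mem_interior hp (h1 h2)]
      rfl
    rw [integral_congr_ae hae, setIntegral_const]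
    have hQ0 : ((volume.real Q : ℝ) : ℂ) ≠ 0 := by exact_mod_cast hQpos.ne'
    have hrw : Ψ Q - ν.real Q • (Ψ Q / ((volume.real Q : ℝ) : ℂ)) =
        Ψ Q * (((volume.restrict F).real Q / volume.real Q : ℝ) : ℂ) := by
      rw [Complex.real_smul, eq_sub_of_add_eq hsplit.symm]
      push_cast
      field_simp
    rw [hrw, norm_mul, Complex.norm_real, Real.norm_of_nonneg (by positivity)]
    have hM0 : (0 : ℝ) ≤ (M : ℝ) ^ d := by positivity
    calc ‖Ψ Q‖ * ((volume.restrict F).real Q / volume.real Q)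
        ≤ (lam * volume.real Q) * ((volume.restrict F).real Q / volume.real Q) := by gcongr
      _ = 1 * lam * (volume.restrict F).real Q := by field_simp
      _ ≤ _ := by gcongr; linarith
  | succ n ih =>
    intro k c hcZ hc
    have hQ : cell p k c ∈ Lambda p := ⟨k, c, rfl⟩
    set J : ((j : Fin d) → Fin (p j k)) → Set (Fin d → ℝ) :=
      fun b => cell p (k + 1) (subCorner (fun j => p j k) c b) with hJdef
    have hJ : ∀ b, J b ∈ Lambda p := fun b => ⟨_, _, rfl⟩
    have hJd : ∀ a b, a ≠ b → Disjoint (interior (J a)) (interior (J b)) := fun a b hab =>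
      disjoint_interior_gridBox (fun j => mseq_pos (hp j) (k + 1))
        fun h => hab (subCorner_injective _ c h)
    have hJU : (⋃ b, J b) = cell p k c := iUnion_cell_succ hp k c
    have hJZ : ∀ b, J b ⊆ Z := fun b => (hJU ▸ Set.subset_iUnion J b).trans hcZ
    by_cases hgood : ∀ b, ‖Ψ (J b)‖ ≤ lam * volume.real (J b)
    · have h1 := hΨ.eq_sum hJ hJd hQ hJU
      have h2 := setIntegral_iUnion_Lambda hνv hJ hJd
        (by rw [hJU]; exact hint hQ hcZ (k + (n + 1)))
      have h3 : (volume.restrict F).real (cell p k c) =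
          ∑ b, (volume.restrict F).real (J b) := by
        have := setIntegral_iUnion_Lambda (ν := volume.restrict F) (g := fun _ => (1 : ℝ))
          (Measure.absolutelyContinuous_of_le Measure.restrict_le_self) hJ hJd
          (by
            rw [hJU]
            exact integrableOn_const ((Measure.restrict_apply_le _ _).trans_lt
              (volume_ne_top_of_mem_Lambda hQ).lt_top).ne)
        simpa [hJU] using this
      rw [hJU] at h2
      rw [h1, h2, ← Finset.sum_sub_distrib, h3, Finset.mul_sum]
      refine (norm_sum_le _ _).trans (Finset.sum_le_sum fun b _ => ?_)
      have := ih (k + 1) _ (hJZ b) (hgood b)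
      rwa [add_right_comm, add_assoc] at this
    · push Not at hgood
      obtain ⟨b, hb⟩ := hgood
      have hbF : J b ⊆ F := by
        simpa [Set.inter_eq_left.2 (hJZ b)] using hbad _ (hJ b) hb
      have hvol : volume.real (cell p k c) ≤
          (M : ℝ) ^ d * (volume.restrict F).real (cell p k c) := by
        refine (volume_real_cell_succ k c (subCorner (fun j => p j k) c b) hM hp).trans ?_
        gcongr
        have hle : (volume.restrict F).real (J b) ≤ (volume.restrict F).real (cell p k c) :=
          measureReal_mono (hJU ▸ Set.subset_iUnion J b) ((Measure.restrict_apply_le _ _).trans_lt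
            (volume_ne_top_of_mem_Lambda hQ).lt_top).ne
        rwa [measureReal_restrict_apply (measurableSet_of_mem_Lambda (hJ b)),
          Set.inter_eq_left.2 hbF] at hle
      have hI : ‖∫ x in cell p k c, cellAvg p Ψ (k + (n + 1)) x ∂ν‖ ≤
          lam * volume.real (cell p k c) := by
        refine (norm_setIntegral_le_of_norm_le_const_ae (hfin hQ) (hboundQ hQ hcZ _)).trans ?_
        gcongr
        exact ENNReal.toReal_mono (volume_ne_top_of_mem_Lambda hQ)
          (Measure.restrict_apply_le _ _)
      calc _ ≤ ‖Ψ (cell p k c)‖ + ‖∫ x in cell p k c, cellAvg p Ψ (k + (n + 1)) x ∂ν‖ :=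
            norm_sub_le _ _
        _ ≤ 2 * lam * volume.real (cell p k c) := by linarith
        _ ≤ 2 * lam * ((M : ℝ) ^ d * (volume.restrict F).real (cell p k c)) := by gcongr
        _ ≤ _ := by
          have : 0 ≤ lam * (volume.restrict F).real (cell p k c) := by positivity
          linarith

lemma nullMeasurableSet_inter_starGt {L : Set (Fin d → ℝ)} (hL : MeasurableSet L)
    {H : (Fin d → ℝ) → ℝ} (hH : IntegrableOn H L) :
    NullMeasurableSet (L ∩ starGt p Ψ H) volume := by
  have hS : starGt p Ψ H = ⋃ Q ∈ Lambda p, Q ∩ {x | H x < ‖Ψ Q‖ / (volume Q).toReal} := by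
    ext x
    simp [starGt, and_left_comm]
  rw [Set.inter_comm, ← nullMeasurableSet_restrict hL.nullMeasurableSet, hS]
  refine NullMeasurableSet.biUnion countable_Lambda fun Q hQ => ?_
  exact (measurableSet_of_mem_Lambda hQ).nullMeasurableSet.inter
    (nullMeasurableSet_lt hH.aemeasurable aemeasurable_const)

lemma norm_trunc_le {α : Type*} {f : α → ℂ} {H : α → ℝ} {x : α} (hx : 0 ≤ H x) :
    ‖trunc f H x‖ ≤ H x := by
  rw [trunc]
  split_ifs with h
  · exact h
  · simpa using hx

lemma integrableOn_trunc {L : Set (Fin d → ℝ)} (hL : MeasurableSet L)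
    {H : (Fin d → ℝ) → ℝ} (hH0 : ∀ x ∈ L, 0 ≤ H x) (hH : IntegrableOn H L)
    {f : (Fin d → ℝ) → ℂ} (hf : AEStronglyMeasurable f (volume.restrict L)) :
    IntegrableOn (trunc f H) L := by
  classical
  have heq : trunc f H = {x | ‖f x‖ ≤ H x}.indicator f := by
    ext x
    simp [trunc, Set.indicator_apply]
  refine Integrable.mono' hH ?_ ((ae_restrict_mem hL).mono fun x hx => norm_trunc_le (hH0 x hx))
  rw [heq]
  exact hf.indicator₀ (nullMeasurableSet_le hf.norm.aemeasurable hH.aemeasurable)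

lemma norm_setIntegral_trunc_sub_le (hp : ∀ j i, 2 ≤ p j i) {M : ℕ} (hM : ∀ j i, p j i ≤ M)
    (hΨ : IsAdditive p Ψ) {L : Set (Fin d → ℝ)} (hL : L ∈ Lambda p)
    {H : (Fin d → ℝ) → ℝ} (hH0 : ∀ x ∈ L, 0 ≤ H x) {C : ℝ} (hC0 : 0 < C)
    (hC : ∀ x ∈ L, ∀ y ∈ L, H x ≤ C * H y) (hH : IntegrableOn H L)
    {f : (Fin d → ℝ) → ℂ}
    (hderiv : ∀ᵐ x ∂volume.restrict L, Tendsto (fun k => cellAvg p Ψ k x) atTop (𝓝 (f x)))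
    (hlt : ∫ x in L ∩ starGt p Ψ H, H x < ∫ x in L, H x) :
    ‖(∫ x in L, trunc f H x) - Ψ L‖ ≤
      (2 * (M : ℝ) ^ d + 2) * C ^ 2 * ∫ x in L ∩ starGt p Ψ H, H x := by
  have hLm := measurableSet_of_mem_Lambda hL
  have hLfin := volume_ne_top_of_mem_Lambda hL
  obtain ⟨y, hy⟩ := nonempty_of_mem_Lambda hp hL
  set F := L ∩ starGt p Ψ H with hFdef
  have hF : NullMeasurableSet F volume := nullMeasurableSet_inter_starGt hLm hH
  have hFL : F ⊆ L := Set.inter_subset_left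
  have hFfin : volume F ≠ ⊤ := measure_ne_top_of_subset hFL hLfin
  obtain ⟨lam, hlam⟩ : ∃ lam, lam = C * H y := ⟨_, rfl⟩
  have hlam0 : 0 ≤ lam := hlam ▸ mul_nonneg hC0.le (hH0 y hy)
  have hHlam : ∀ x ∈ L, H x ≤ lam := fun x hx => hlam ▸ hC x hx y hy
  have hlamH : ∀ x ∈ L, lam ≤ C ^ 2 * H x := fun x hx => by
    rw [hlam, pow_two, mul_assoc]
    exact mul_le_mul_of_nonneg_left (hC y hy x hx) hC0.le
  have hbad : ∀ Q ∈ Lambda p, lam * volume.real Q < ‖Ψ Q‖ → Q ∩ L ⊆ F :=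
    fun Q hQ hlt x hx => ⟨hx.2, Q, hQ, hx.1, (hHlam x hx.2).trans_lt
      ((lt_div_iff₀ (volume_real_pos_of_mem_Lambda hp hQ)).2 hlt)⟩
  have havgH : ∀ k, ∀ x ∈ L, x ∉ F → ‖cellAvg p Ψ k x‖ ≤ H x := fun k x hx hxF =>
    norm_cellAvg_le_of_notMem_starGt hp (fun h => hxF ⟨hx, h⟩) k
  have havg : ∀ k, ∀ x ∈ L, x ∉ F → ‖cellAvg p Ψ k x‖ ≤ lam := fun k x hx hxF =>
    (havgH k x hx hxF).trans (hHlam x hx)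
  have hΨL : ‖Ψ L‖ ≤ lam * volume.real L := by
    by_contra! hcon
    have hLF : F = L := hFL.antisymm (by simpa using hbad L hL hcon)
    rw [hLF] at hlt
    exact lt_irrefl _ hlt
  have hrestr : (volume.restrict Fᶜ).restrict L = volume.restrict (L \ F) := by
    rw [Measure.restrict_restrict hLm, Set.sdiff_eq]
  have hmemdiff : ∀ᵐ x ∂volume.restrict (L \ F), x ∈ L \ F :=
    ae_restrict_mem₀ (hLm.nullMeasurableSet.diff hF)
  have hderiv' : ∀ᵐ x ∂volume.restrict (L \ F),
      Tendsto (fun k => cellAvg p Ψ k x) atTop (𝓝 (f x)) :=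
    ae_mono (Measure.restrict_mono Set.sdiff_subset le_rfl) hderiv
  have hfm : AEStronglyMeasurable f (volume.restrict L) :=
    aestronglyMeasurable_of_tendsto_ae atTop
      (fun k => (measurable_cellAvg k).aestronglyMeasurable) hderiv
  have hoff : ‖Ψ L - ∫ x in L \ F, f x‖ ≤
      (2 * (M : ℝ) ^ d + 1) * lam * volume.real F := by
    obtain ⟨k, c, hkc⟩ := hL
    have hbnd : ∀ n, ‖Ψ L - ∫ x in L \ F, cellAvg p Ψ (k + n) x‖ ≤
        (2 * (M : ℝ) ^ d + 1) * lam * volume.real F := fun n => by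
      have := norm_sub_setIntegral_cellAvg_le hp hM hΨ hF hlam0 hbad havg n k c hkc.ge
        (hkc ▸ hΨL)
      rwa [← hkc, hrestr, measureReal_restrict_apply hLm, Set.inter_eq_right.2 hFL] at this
    have : IsFiniteMeasure (volume.restrict (L \ F)) :=
      ⟨by simpa using (measure_ne_top_of_subset Set.sdiff_subset hLfin).lt_top⟩
    have hlim : Tendsto (fun n => ∫ x in L \ F, cellAvg p Ψ (k + n) x) atTop
        (𝓝 (∫ x in L \ F, f x)) := by
      refine tendsto_integral_of_dominated_convergence (fun _ => lam)
        (fun n => (measurable_cellAvg _).aestronglyMeasurable) (integrable_const _)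
        (fun n => hmemdiff.mono fun x hx => havg _ x hx.1 hx.2)
        (hderiv'.mono fun x hx => hx.comp ?_)
      exact tendsto_atTop_mono (fun n => Nat.le_add_left n k) tendsto_id
    exact le_of_tendsto (tendsto_const_nhds.sub hlim).norm (Eventually.of_forall hbnd)
  have htr : ∫ x in L \ F, trunc f H x = ∫ x in L \ F, f x := by
    refine integral_congr_ae ?_
    filter_upwards [hmemdiff, hderiv'] with x hx hlim
    exact if_pos (le_of_tendsto hlim.norm (Eventually.of_forall fun k => havgH k x hx.1 hx.2))
  have hon : ‖∫ x in F, trunc f H x‖ ≤ lam * volume.real F :=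
    norm_setIntegral_le_of_norm_le_const_ae hFfin.lt_top
      ((ae_restrict_mem₀ hF).mono fun x hx =>
        (norm_trunc_le (hH0 x (hFL hx))).trans (hHlam x (hFL hx)))
  have hsplit := integral_inter_add_sdiff₀ hF (integrableOn_trunc hLm hH0 hH hfm)
  rw [Set.inter_eq_right.2 hFL, htr] at hsplit
  have hvolF : lam * volume.real F ≤ C ^ 2 * ∫ x in F, H x := by
    have hconst : ∫ _x in F, lam = lam * volume.real F := by
      rw [setIntegral_const, smul_eq_mul, mul_comm]
    rw [← hconst, ← integral_const_mul]
    exact integral_mono_ae (integrableOn_const hFfin) ((hH.mono_set hFL).const_mul _)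
      ((ae_restrict_mem₀ hF).mono fun x hx => hlamH x (hFL hx))
  rw [← hsplit]
  calc ‖(∫ x in F, trunc f H x) + (∫ x in L \ F, f x) - Ψ L‖
      = ‖(∫ x in F, trunc f H x) - (Ψ L - ∫ x in L \ F, f x)‖ := by congr 1; ring
    _ ≤ ‖∫ x in F, trunc f H x‖ + ‖Ψ L - ∫ x in L \ F, f x‖ := norm_sub_le _ _
    _ ≤ (2 * (M : ℝ) ^ d + 2) * (lam * volume.real F) := by linarith
    _ ≤ (2 * (M : ℝ) ^ d + 2) * (C ^ 2 * ∫ x in F, H x) := by gcongr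
    _ = _ := by ring

lemma HConds.integrableOn {I0 : Set (Fin d → ℝ)} {h : ℕ → (Fin d → ℝ) → ℝ}
    (hh : HConds p I0 h) (m : ℕ) : IntegrableOn (h m) I0 := by
  obtain ⟨-, C, -, ε, hε, hpart⟩ := hh
  obtain ⟨s, J, -, -, hU, -, hint⟩ := hpart m
  rw [← hU, integrableOn_finite_iUnion]
  exact fun i => Integrable.of_integral_ne_zero (hε.trans_le (hint i)).ne'

/-- Reconstruction of `Ψ` on a single parallelepiped contained in `I0`. -/
lemma tendsto_setIntegral_trunc (hp : ∀ j i, 2 ≤ p j i) {M : ℕ} (hM : ∀ j i, p j i ≤ M)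
    (hΨ : IsAdditive p Ψ) {I0 : Set (Fin d → ℝ)} (hI0 : I0 ∈ Lambda p)
    {h : ℕ → (Fin d → ℝ) → ℝ} (hh : HConds p I0 h)
    (hsmall : Tendsto (fun m => ∫ x in I0 ∩ starGt p Ψ (h m), h m x) atTop (𝓝 0))
    {f : (Fin d → ℝ) → ℂ}
    (hderiv : ∀ᵐ x ∂volume.restrict I0, Tendsto (fun k => cellAvg p Ψ k x) atTop (𝓝 (f x)))
    {I : Set (Fin d → ℝ)} (hI : I ∈ Lambda p) (hsub : I ⊆ I0) :
    Tendsto (fun m => ∫ x in I, trunc f (h m) x) atTop (𝓝 (Ψ I)) := by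
  have hint := hh.integrableOn
  obtain ⟨hmono, C, hC0, ε, hε, hpart⟩ := hh
  obtain ⟨y, hy⟩ := nonempty_of_mem_Lambda hp hI
  have hIpos := volume_real_pos_of_mem_Lambda hp hI
  have hIm := measurableSet_of_mem_Lambda hI
  have hI0m := measurableSet_of_mem_Lambda hI0
  have hfm : AEStronglyMeasurable f (volume.restrict I0) :=
    aestronglyMeasurable_of_tendsto_ae atTop
      (fun k => (measurable_cellAvg k).aestronglyMeasurable) hderiv
  have hmin : 0 < min ε (C⁻¹ * volume.real I) := lt_min hε (by positivity)
  refine tendsto_iff_norm_sub_tendsto_zero.2 (squeeze_zero' (Eventually.of_forall fun _ =>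
    norm_nonneg _) ?_ (by simpa using hsmall.const_mul ((2 * (M : ℝ) ^ d + 2) * C ^ 2)))
  filter_upwards [(hmono y (hsub hy)).2.2.eventually_ge_atTop 1,
    hsmall.eventually_lt_const hmin] with m hym hsm
  obtain ⟨s, J, hJ, hJd, hJU, hJC, hJε⟩ := hpart m
  have hpos : ∀ x ∈ I0, 0 ≤ h m x := fun x hx => (hmono x hx).1 m
  obtain ⟨ι, _, K, hK, hKd, hKU, hKC, hKε⟩ : ∃ (ι : Type) (_ : Fintype ι)
      (K : ι → Set (Fin d → ℝ)), (∀ i, K i ∈ Lambda p) ∧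
      (∀ i j, i ≠ j → Disjoint (interior (K i)) (interior (K j))) ∧ (⋃ i, K i) = I ∧
      (∀ i, ∀ x ∈ K i, ∀ y ∈ K i, h m x ≤ C * h m y) ∧
      ∀ i, min ε (C⁻¹ * volume.real I) ≤ ∫ x in K i, h m x := by
    rcases subset_or_iUnion_eq hp hJ hI (hJU ▸ hsub) with ⟨i, hi⟩ | hU
    · refine ⟨Unit, inferInstance, fun _ => I, fun _ => hI, fun i j hij => absurd rfl hij,
        Set.iUnion_const I, fun _ x hx y hy => hJC i x (hi hx) y (hi hy), fun _ => ?_⟩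
      refine (min_le_right _ _).trans ?_
      have hconst : ∫ _x in I, C⁻¹ = C⁻¹ * volume.real I := by
        rw [setIntegral_const, smul_eq_mul, mul_comm]
      rw [← hconst]
      refine setIntegral_mono_on (integrableOn_const (volume_ne_top_of_mem_Lambda hI))
        ((hint m).mono_set hsub) hIm fun x hx => ?_
      rw [inv_le_iff_one_le_mul₀' hC0]
      exact hym.trans (hJC i y (hi hy) x (hi hx))
    · classical
      exact ⟨{i // J i ⊆ I}, inferInstance, fun i => J i, fun i => hJ i,
        fun i j hij => hJd i j fun h => hij (Subtype.ext h), hU, fun i => hJC i,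
        fun i => (min_le_left _ _).trans (hJε i)⟩
  have hKI : ∀ i, K i ⊆ I := fun i => hKU ▸ Set.subset_iUnion K i
  set S := starGt p Ψ (h m) with hS
  have hSv : volume.restrict S ≪ volume :=
    Measure.absolutelyContinuous_of_le Measure.restrict_le_self
  have hintS : IntegrableOn (h m) I0 (volume.restrict S) := by
    have := hint m
    unfold IntegrableOn at this ⊢
    rw [Measure.restrict_restrict hI0m]
    exact this.mono_measure (Measure.restrict_mono Set.inter_subset_left le_rfl)
  have hle : ∀ A, MeasurableSet A → A ⊆ I0 →
      ∫ x in A ∩ S, h m x ≤ ∫ x in I0 ∩ S, h m x := fun A hA hAI => by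
    rw [← Measure.restrict_restrict hA, ← Measure.restrict_restrict hI0m]
    exact setIntegral_mono_set hintS ((ae_restrict_mem hI0m).mono hpos) hAI.eventuallyLE
  have hest : ∀ i, ‖(∫ x in K i, trunc f (h m) x) - Ψ (K i)‖ ≤
      (2 * (M : ℝ) ^ d + 2) * C ^ 2 * ∫ x in K i ∩ S, h m x := fun i => by
    have hKI0 := (hKI i).trans hsub
    refine norm_setIntegral_trunc_sub_le hp hM hΨ (hK i) (fun x hx => hpos x (hKI0 hx)) hC0
      (hKC i) ((hint m).mono_set hKI0)
      (ae_mono (Measure.restrict_mono hKI0 le_rfl) hderiv) ?_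
    exact (hle _ (measurableSet_of_mem_Lambda (hK i)) hKI0).trans_lt (hsm.trans_le (hKε i))
  have htrunc : IntegrableOn (trunc f (h m)) (⋃ i, K i) :=
    hKU ▸ (integrableOn_trunc hI0m hpos (hint m) hfm).mono_set hsub
  have hsum := setIntegral_iUnion_Lambda Measure.AbsolutelyContinuous.rfl hK hKd htrunc
  have hsumS := setIntegral_iUnion_Lambda hSv hK hKd (hKU ▸ hintS.mono_set hsub)
  rw [hKU] at hsum hsumS
  rw [hsum, hΨ.eq_sum hK hKd hI hKU, ← Finset.sum_sub_distrib]
  calc _ ≤ ∑ i, (2 * (M : ℝ) ^ d + 2) * C ^ 2 * ∫ x in K i ∩ S, h m x :=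
        (norm_sum_le _ _).trans (Finset.sum_le_sum fun i _ => hest i)
    _ = (2 * (M : ℝ) ^ d + 2) * C ^ 2 * ∫ x in I ∩ S, h m x := by
        rw [← Finset.mul_sum, ← Measure.restrict_restrict hIm, hsumS]
        simp only [Measure.restrict_restrict (measurableSet_of_mem_Lambda (hK _))]
    _ ≤ _ := mul_le_mul_of_nonneg_left (hle I hIm hsub) (by positivity)

end Reconstruction

/-- **Remark (extension to products of `𝒫`-adic intervals of different ranks).**
Under the hypotheses of the reconstruction theorem, a product
`I = [n₁/m¹_{k₁},(n₁+1)/m¹_{k₁}] × ⋯ × [n_d/mᵈ_{k_d},(n_d+1)/mᵈ_{k_d}] ⊆ I₀` of `𝒫`-adic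
intervals of possibly different ranks can be written as a finite union of members of `Λᵈ`
with pairwise disjoint interiors; and for any such decomposition `I = J 1 ∪ ⋯ ∪ J s`,
setting `Ψ(I) := ∑ Ψ(J i)` (independent of the decomposition, the limit being unique),
`Ψ(I) = lim_m ∫_I [Ψ'(x)]_{h m x} dx`. -/
theorem reconstruction_additive_function_mixed_ranks
    (d : ℕ) (p : Fin d → ℕ → ℕ) (hp : ∀ j i, 2 ≤ p j i)
    (M : ℕ) (hM : ∀ j i, p j i ≤ M)
    (Ψ : Set (Fin d → ℝ) → ℂ) (hΨ : IsAdditive p Ψ)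
    (I0 : Set (Fin d → ℝ)) (hI0 : I0 ∈ Lambda p)
    (h : ℕ → (Fin d → ℝ) → ℝ) (hh : HConds p I0 h)
    (hsmall : Tendsto (fun m => ∫ x in I0 ∩ starGt p Ψ (h m), h m x) atTop (𝓝 0))
    (f : (Fin d → ℝ) → ℂ)
    (hderiv : ∀ᵐ x ∂(volume.restrict I0),
      Tendsto (fun k => Ψ (cellAt p k x) / ((volume (cellAt p k x)).toReal : ℂ))
        atTop (𝓝 (f x)))
    (kk : Fin d → ℕ) (nn : Fin d → ℤ) (I : Set (Fin d → ℝ))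
    (hIdef : I = Set.univ.pi fun j =>
      Set.Icc ((nn j : ℝ) / (mseq (p j) (kk j) : ℝ))
        (((nn j : ℝ) + 1) / (mseq (p j) (kk j) : ℝ)))
    (hsub : I ⊆ I0) :
    (∃ (s : ℕ) (J : Fin s → Set (Fin d → ℝ)),
      (∀ i, J i ∈ Lambda p) ∧
      (∀ i j, i ≠ j → Disjoint (interior (J i)) (interior (J j))) ∧
      (⋃ i, J i) = I) ∧
    (∀ (s : ℕ) (J : Fin s → Set (Fin d → ℝ)),
      (∀ i, J i ∈ Lambda p) →
      (∀ i j, i ≠ j → Disjoint (interior (J i)) (interior (J j))) →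
      (⋃ i, J i) = I →
      Tendsto (fun m => ∫ x in I, trunc f (h m) x) atTop (𝓝 (∑ i, Ψ (J i)))) := by
  subst hIdef
  refine ⟨exists_decomposition_gridBox hp kk nn, fun s J hJ hJd hJU => ?_⟩
  have hfm : AEStronglyMeasurable f (volume.restrict I0) :=
    aestronglyMeasurable_of_tendsto_ae atTop
      (fun k => (measurable_cellAvg (p := p) (Ψ := Ψ) k).aestronglyMeasurable) hderiv
  have hsum : ∀ m, ∫ x in ⋃ i, J i, trunc f (h m) x = ∑ i, ∫ x in J i, trunc f (h m) x :=
    fun m => setIntegral_iUnion_Lambda Measure.AbsolutelyContinuous.rfl hJ hJd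
      ((integrableOn_trunc (measurableSet_of_mem_Lambda hI0) (fun x hx => (hh.1 x hx).1 m)
        (hh.integrableOn m) hfm).mono_set (hJU ▸ hsub))
  rw [← hJU]
  simp only [hsum]
  exact tendsto_finsetSum _ fun i _ => tendsto_setIntegral_trunc hp hM hΨ hI0 hh hsmall hderiv
    (hJ i) (((Set.subset_iUnion J i).trans hJU.subset).trans hsub)
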